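/- There exist constants C > 1 and n₀ ≥ 1 such that for every integer n ≥ n₀ and every ψ ∈ (arccos(1/a), π/2) with 1 − 1/n² < a·cos ψ < 1 − 1/(n+1)², the function ζ is twice differentiable at ψ and C^{-1}·n⁵ ≤ ζ''(ψ) ≤ C·n⁵. -/

import Mathlib

open MeasureTheory Set Real

noncomputable section

/-- The profile of the surface of revolution: `ξ(s) = 1` for `s ≤ L` and
`ξ(s) = 1 + (s-L)^r` for `s ≥ L`. -/
def profileXi (r L : ℝ) (s : ℝ) : ℝ := if s ≤ L then 1 else 1 + (s - L) ^ r

/-- The derivative of the profile. -/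
def profileXi' (r L : ℝ) (s : ℝ) : ℝ := if s ≤ L then 0 else r * (s - L) ^ (r - 1)

/-- `A(s) = √(1 + ξ'(s)²)/ξ(s)`. -/
def profileA (r L : ℝ) (s : ℝ) : ℝ :=
  Real.sqrt (1 + profileXi' r L s ^ 2) / profileXi r L s

/-- The angular displacement function of crossing geodesics:
`ζ(ψ) = 2 a cos ψ ∫₀^{ε₁} A(s) (ξ(s)² - a² cos² ψ)^{-1/2} ds`, where `a = ξ(ε₁)`. -/
def zetaFun (r L ε₁ a : ℝ) (ψ : ℝ) : ℝ :=
  2 * a * Real.cos ψ *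
    ∫ s in (0:ℝ)..ε₁,
      profileA r L s * (profileXi r L s ^ 2 - a ^ 2 * Real.cos ψ ^ 2) ^ (-(1/2) : ℝ)

/-- Differentiation under the integral sign for `c ↦ ∫ w (f² - c²) ^ p` with `f ≥ 1`, `|c| < 1`. -/
theorem hasDerivAt_integral_mul_sq_sub_sq_rpow {f w : ℝ → ℝ} (hf : Continuous f)
    (hw : Continuous w) (hf1 : ∀ s, 1 ≤ f s) (α β : ℝ) {p c : ℝ} (hp : p ≤ 0) (hc : c ^ 2 < 1) :
    HasDerivAt (fun x => ∫ s in α..β, w s * (f s ^ 2 - x ^ 2) ^ p)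
      (-2 * p * c * ∫ s in α..β, w s * (f s ^ 2 - c ^ 2) ^ (p - 1)) c := by
  obtain ⟨ρ, hcρ, hρ⟩ := exists_between hc
  have hpos : ∀ {x : ℝ}, x ^ 2 < 1 → ∀ s, 0 < f s ^ 2 - x ^ 2 := fun {x} hx s => by
    nlinarith [hf1 s]
  have hcont : ∀ {x : ℝ} (q : ℝ), x ^ 2 < 1 → Continuous fun s => (f s ^ 2 - x ^ 2) ^ q :=
    fun {x} q hx => Continuous.rpow_const (by fun_prop) fun s => Or.inl (hpos hx s).ne'
  have hnhds : {x : ℝ | x ^ 2 < ρ} ∈ nhds c :=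
    (isOpen_lt (by fun_prop) continuous_const).mem_nhds hcρ
  have key := intervalIntegral.hasDerivAt_integral_of_dominated_loc_of_deriv_le
    (μ := volume) (a := α) (b := β)
    (F := fun x s => w s * (f s ^ 2 - x ^ 2) ^ p)
    (F' := fun x s => w s * ((-(2 * x)) * p * (f s ^ 2 - x ^ 2) ^ (p - 1)))
    (bound := fun s => |w s| * (2 * |p| * (1 - ρ) ^ (p - 1))) hnhds
    (Filter.eventually_of_mem hnhds fun x hx =>
      (hw.mul (hcont p (lt_trans hx hρ))).aestronglyMeasurable)
    ((hw.mul (hcont p hc)).intervalIntegrable _ _)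
    ((hw.mul (continuous_const.mul (hcont (p - 1) hc))).aestronglyMeasurable)
    (Filter.Eventually.of_forall fun s _ x hx => ?_)
    ((hw.abs.mul continuous_const).intervalIntegrable _ _)
    (Filter.Eventually.of_forall fun s _ x hx => ?_)
  · refine key.2.congr_deriv ?_
    rw [← intervalIntegral.integral_const_mul]
    congr 1
    ext s
    ring
  · have hx' : x ^ 2 < ρ := hx
    have h1 : (f s ^ 2 - x ^ 2) ^ (p - 1) ≤ (1 - ρ) ^ (p - 1) :=
      Real.rpow_le_rpow_of_nonpos (by linarith) (by nlinarith [hf1 s]) (by linarith)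
    have h2 : 0 ≤ (f s ^ 2 - x ^ 2) ^ (p - 1) :=
      (Real.rpow_pos_of_pos (hpos (hx'.trans hρ) s) _).le
    have h3 : |x| ≤ 1 := (sq_le_one_iff_abs_le_one x).1 (hx'.trans hρ).le
    rw [Real.norm_eq_abs, abs_mul, abs_mul, abs_mul, abs_neg, abs_mul, abs_two, abs_of_nonneg h2]
    gcongr
    nlinarith [abs_nonneg p]
  · have hx' : x ^ 2 < ρ := hx
    have h1 : HasDerivAt (fun y : ℝ => f s ^ 2 - y ^ 2) (-(2 * x)) x := by
      simpa using (hasDerivAt_pow 2 x).const_sub (f s ^ 2)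
    exact (h1.rpow_const (Or.inl (hpos (hx'.trans hρ) s).ne')).const_mul (w s)

theorem profileXi_eq {r : ℝ} (hr : 0 < r) (L s : ℝ) :
    profileXi r L s = 1 + max (s - L) 0 ^ r := by
  unfold profileXi
  split_ifs with h
  · rw [max_eq_right (by linarith), Real.zero_rpow hr.ne', add_zero]
  · rw [max_eq_left (by linarith)]

theorem profileXi'_eq {r : ℝ} (hr : 1 < r) (L s : ℝ) :
    profileXi' r L s = r * max (s - L) 0 ^ (r - 1) := by
  unfold profileXi'
  split_ifs with h
  · rw [max_eq_right (by linarith), Real.zero_rpow (by linarith), mul_zero]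
  · rw [max_eq_left (by linarith)]

theorem one_le_profileXi {r : ℝ} (hr : 0 < r) (L s : ℝ) : 1 ≤ profileXi r L s := by
  rw [profileXi_eq hr]
  have : 0 ≤ max (s - L) 0 ^ r := Real.rpow_nonneg (le_max_right _ _) _
  linarith

theorem profileXi_le {r : ℝ} (hr : 0 < r) {L s t : ℝ} (hLt : L ≤ t) (hst : s ≤ t) :
    profileXi r L s ≤ 1 + (t - L) ^ r := by
  rw [profileXi_eq hr]
  gcongr
  exact max_le (by linarith) (by linarith)

theorem continuous_profileXi {r : ℝ} (hr : 0 < r) (L : ℝ) : Continuous (profileXi r L) := by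
  rw [funext (profileXi_eq hr L)]
  exact continuous_const.add (Continuous.rpow_const (by fun_prop) fun _ => Or.inr hr.le)

theorem continuous_profileXi' {r : ℝ} (hr : 1 < r) (L : ℝ) : Continuous (profileXi' r L) := by
  rw [funext (profileXi'_eq hr L)]
  exact continuous_const.mul
    (Continuous.rpow_const (by fun_prop) fun _ => Or.inr (by linarith))

theorem continuous_profileA {r : ℝ} (hr : 1 < r) (L : ℝ) : Continuous (profileA r L) := by
  have h := continuous_profileXi' hr L
  have hr0 : 0 < r := by linarith
  exact (Real.continuous_sqrt.comp (by fun_prop)).div (continuous_profileXi hr0 L)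
    fun s => by linarith [one_le_profileXi hr0 L s]

theorem profileA_nonneg {r : ℝ} (hr : 0 < r) (L s : ℝ) : 0 ≤ profileA r L s :=
  div_nonneg (Real.sqrt_nonneg _) (by linarith [one_le_profileXi hr L s])

/-- The integrals `∫₀^{ε₁} A(s) (ξ(s)² - c²)^p ds`. -/
def crossingIntegral (r L ε₁ p c : ℝ) : ℝ :=
  ∫ s in (0:ℝ)..ε₁, profileA r L s * (profileXi r L s ^ 2 - c ^ 2) ^ p

theorem hasDerivAt_crossingIntegral {r : ℝ} (hr : 1 < r) (L ε₁ : ℝ) {p c : ℝ} (hp : p ≤ 0)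
    (hc : c ^ 2 < 1) :
    HasDerivAt (crossingIntegral r L ε₁ p)
      (-2 * p * c * crossingIntegral r L ε₁ (p - 1) c) c :=
  have hr0 : 0 < r := by linarith
  hasDerivAt_integral_mul_sq_sub_sq_rpow (continuous_profileXi hr0 L) (continuous_profileA hr L)
    (one_le_profileXi hr0 L) 0 ε₁ hp hc

theorem zetaFun_eq (r L ε₁ a ψ : ℝ) :
    zetaFun r L ε₁ a ψ =
      2 * (a * Real.cos ψ) * crossingIntegral r L ε₁ (-(1 / 2)) (a * Real.cos ψ) := by
  simp only [zetaFun, crossingIntegral, mul_pow, mul_assoc]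

theorem hasDerivAt_zetaFun {r : ℝ} (hr : 1 < r) (L ε₁ a : ℝ) {ψ : ℝ}
    (hψ : (a * Real.cos ψ) ^ 2 < 1) :
    HasDerivAt (zetaFun r L ε₁ a)
      (-2 * (a * Real.sin ψ) * (crossingIntegral r L ε₁ (-(1 / 2)) (a * Real.cos ψ) +
        (a * Real.cos ψ) ^ 2 * crossingIntegral r L ε₁ (-(3 / 2)) (a * Real.cos ψ))) ψ := by
  rw [funext (zetaFun_eq r L ε₁ a)]
  have hc := (Real.hasDerivAt_cos ψ).const_mul a
  have h := (hasDerivAt_crossingIntegral hr L ε₁ (p := -(1 / 2)) (by norm_num) hψ).comp ψ hc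
  refine ((hc.const_mul 2).mul h).congr_deriv ?_
  rw [show (-(1 / 2) - 1 : ℝ) = -(3 / 2) by norm_num, Function.comp_apply]
  ring

theorem hasDerivAt_deriv_zetaFun {r : ℝ} (hr : 1 < r) (L ε₁ a : ℝ) {ψ : ℝ}
    (hψ : (a * Real.cos ψ) ^ 2 < 1) :
    HasDerivAt (deriv (zetaFun r L ε₁ a))
      (2 * (a * Real.cos ψ) *
        (3 * (a ^ 2 - (a * Real.cos ψ) ^ 2) *
          (crossingIntegral r L ε₁ (-(3 / 2)) (a * Real.cos ψ) +
            (a * Real.cos ψ) ^ 2 * crossingIntegral r L ε₁ (-(5 / 2)) (a * Real.cos ψ)) -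
        (crossingIntegral r L ε₁ (-(1 / 2)) (a * Real.cos ψ) +
          (a * Real.cos ψ) ^ 2 * crossingIntegral r L ε₁ (-(3 / 2)) (a * Real.cos ψ)))) ψ := by
  have hnhds : {φ : ℝ | (a * Real.cos φ) ^ 2 < 1} ∈ nhds ψ :=
    (isOpen_lt (by fun_prop) continuous_const).mem_nhds hψ
  have heq := Filter.eventuallyEq_of_mem hnhds
    fun φ hφ => (hasDerivAt_zetaFun hr L ε₁ a (ψ := φ) hφ).deriv
  refine HasDerivAt.congr_of_eventuallyEq ?_ heq
  have hc := (Real.hasDerivAt_cos ψ).const_mul a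
  have hs := (Real.hasDerivAt_sin ψ).const_mul a
  have h₁ := (hasDerivAt_crossingIntegral hr L ε₁ (p := -(1 / 2)) (by norm_num) hψ).comp ψ hc
  have h₃ := (hasDerivAt_crossingIntegral hr L ε₁ (p := -(3 / 2)) (by norm_num) hψ).comp ψ hc
  refine ((hs.const_mul (-2)).mul (h₁.add ((hc.pow 2).mul h₃))).congr_deriv ?_
  rw [show (-(1 / 2) - 1 : ℝ) = -(3 / 2) by norm_num,
    show (-(3 / 2) - 1 : ℝ) = -(5 / 2) by norm_num]
  simp only [Function.comp_apply, Pi.add_apply, Pi.mul_apply, Pi.pow_apply]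
  have hsq : a ^ 2 - (a * Real.cos ψ) ^ 2 = (a * Real.sin ψ) ^ 2 := by
    linear_combination (-a ^ 2) * Real.sin_sq_add_cos_sq ψ
  rw [hsq]
  push_cast
  ring

/-- The second derivative of `ζ` as a single integral. -/
theorem deriv_deriv_zetaFun {r : ℝ} (hr : 1 < r) (L ε₁ a : ℝ) {ψ : ℝ}
    (hψ : (a * Real.cos ψ) ^ 2 < 1) :
    deriv (deriv (zetaFun r L ε₁ a)) ψ = 2 * (a * Real.cos ψ) * ∫ s in (0:ℝ)..ε₁,
      profileA r L s * profileXi r L s ^ 2 *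
        (3 * a ^ 2 - 2 * (a * Real.cos ψ) ^ 2 - profileXi r L s ^ 2) *
        (profileXi r L s ^ 2 - (a * Real.cos ψ) ^ 2) ^ (-(5 / 2) : ℝ) := by
  rw [(hasDerivAt_deriv_zetaFun hr L ε₁ a hψ).deriv]
  set c := a * Real.cos ψ
  have hr0 : 0 < r := by linarith
  have hpos : ∀ s, 0 < profileXi r L s ^ 2 - c ^ 2 := fun s => by
    nlinarith [one_le_profileXi hr0 L s]
  have hint : ∀ p : ℝ, IntervalIntegrable
      (fun s => profileA r L s * (profileXi r L s ^ 2 - c ^ 2) ^ p) volume 0 ε₁ := fun p =>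
    have hξ := continuous_profileXi hr0 L
    ((continuous_profileA hr L).mul (Continuous.rpow_const (by fun_prop)
      fun s => Or.inl (hpos s).ne')).intervalIntegrable _ _
  unfold crossingIntegral
  congr 1
  rw [← intervalIntegral.integral_const_mul, ← intervalIntegral.integral_const_mul,
    ← intervalIntegral.integral_add (hint _) ((hint _).const_mul _),
    ← intervalIntegral.integral_add (hint _) ((hint _).const_mul _),
    ← intervalIntegral.integral_const_mul,
    ← intervalIntegral.integral_sub (((hint _).add ((hint _).const_mul _)).const_mul _)
      ((hint _).add ((hint _).const_mul _))]
  congr 1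
  ext s
  have h₃ : (profileXi r L s ^ 2 - c ^ 2) ^ (-(3 / 2) : ℝ) =
      (profileXi r L s ^ 2 - c ^ 2) ^ (-(5 / 2) : ℝ) * (profileXi r L s ^ 2 - c ^ 2) := by
    rw [← Real.rpow_add_one (hpos s).ne']
    norm_num
  have h₁ : (profileXi r L s ^ 2 - c ^ 2) ^ (-(1 / 2) : ℝ) =
      (profileXi r L s ^ 2 - c ^ 2) ^ (-(3 / 2) : ℝ) * (profileXi r L s ^ 2 - c ^ 2) := by
    rw [← Real.rpow_add_one (hpos s).ne']
    norm_num
  rw [h₁, h₃]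
  ring

/-- In the band `1/(n+1)² < 1 - c < 1/n²`, the factor `(1 - c²)^{-5/2}` is comparable to `n⁵`. -/
theorem one_sub_sq_rpow_bounds {n : ℕ} (hn : 2 ≤ n) {c : ℝ} (h₁ : 1 - 1 / (n : ℝ) ^ 2 < c)
    (h₂ : c < 1 - 1 / ((n : ℝ) + 1) ^ 2) :
    (n : ℝ) ^ 5 / 32 ≤ (1 - c ^ 2) ^ (-(5 / 2) : ℝ) ∧
      (1 - c ^ 2) ^ (-(5 / 2) : ℝ) ≤ 32 * (n : ℝ) ^ 5 := by
  have hn' : (2 : ℝ) ≤ n := by exact_mod_cast hn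
  have hpow : ∀ x : ℝ, 0 < x → (x ^ 2) ^ (-(5 / 2) : ℝ) = (x ^ 5)⁻¹ := fun x hx => by
    rw [← Real.rpow_natCast x 2, ← Real.rpow_mul hx.le, ← Real.rpow_natCast x 5,
      ← Real.rpow_neg hx.le]
    norm_num
  have hinv : 1 / (n : ℝ) ^ 2 ≤ 1 / 4 := by
    apply one_div_le_one_div_of_le <;> nlinarith
  have hinv' : 1 / (2 * (n : ℝ)) ^ 2 ≤ 1 / ((n : ℝ) + 1) ^ 2 := by
    apply one_div_le_one_div_of_le
    · positivity
    · gcongr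
      linarith
  have hlow : (1 / (2 * (n : ℝ))) ^ 2 ≤ 1 - c ^ 2 := by
    rw [div_pow, one_pow]
    have : 0 < 1 / ((n : ℝ) + 1) ^ 2 := by positivity
    nlinarith
  have hupp : 1 - c ^ 2 ≤ (2 / (n : ℝ)) ^ 2 := by
    rw [div_pow]
    have : 0 < 1 / (n : ℝ) ^ 2 := by positivity
    have h4 : (2 : ℝ) ^ 2 / (n : ℝ) ^ 2 = 4 * (1 / (n : ℝ) ^ 2) := by ring
    nlinarith
  have hlow0 : 0 < (1 / (2 * (n : ℝ))) ^ 2 := by positivity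
  constructor
  · have := Real.rpow_le_rpow_of_nonpos (hlow0.trans_le hlow) hupp
      (by norm_num : (-(5 / 2) : ℝ) ≤ 0)
    rw [hpow _ (by positivity)] at this
    refine le_of_eq_of_le ?_ this
    rw [div_pow, inv_div]
    norm_num
  · have := Real.rpow_le_rpow_of_nonpos hlow0 hlow (by norm_num : (-(5 / 2) : ℝ) ≤ 0)
    rw [hpow _ (by positivity)] at this
    refine this.trans_eq ?_
    rw [div_pow, inv_div, mul_pow]
    norm_num

/-- Lemma 3.2(3a), second derivative: on the `n`-th crossing homogeneity band
`1 - 1/n² < a cos ψ < 1 - 1/(n+1)²`, the function `ζ` is twice differentiable and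
`ζ''(ψ) ≈ n⁵`. -/
theorem zeta_second_deriv_crossing_band
    (r L ε₁ : ℝ) (hr : 4 < r) (hL : 0 < L) (hLε : L < ε₁)
    (a : ℝ) (ha : a = 1 + (ε₁ - L) ^ r) :
    ∃ C : ℝ, 1 < C ∧ ∃ n₀ : ℕ, 1 ≤ n₀ ∧ ∀ n : ℕ, n₀ ≤ n →
      ∀ ψ ∈ Set.Ioo (Real.arccos (1 / a)) (π / 2),
        1 - 1 / (n : ℝ) ^ 2 < a * Real.cos ψ →
        a * Real.cos ψ < 1 - 1 / ((n : ℝ) + 1) ^ 2 →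
        DifferentiableAt ℝ (zetaFun r L ε₁ a) ψ ∧
        DifferentiableAt ℝ (deriv (zetaFun r L ε₁ a)) ψ ∧
        (n : ℝ) ^ 5 / C ≤ deriv (deriv (zetaFun r L ε₁ a)) ψ ∧
        deriv (deriv (zetaFun r L ε₁ a)) ψ ≤ C * (n : ℝ) ^ 5 := by
  have hr1 : 1 < r := by linarith
  have hr0 : 0 < r := by linarith
  have ha1 : 1 < a := by
    rw [ha]
    linarith [Real.rpow_pos_of_pos (sub_pos.2 hLε) r]
  obtain ⟨M, hM⟩ := (isCompact_Icc (a := (0:ℝ)) (b := ε₁)).exists_bound_of_continuousOn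
    (continuous_profileA hr1 L).continuousOn
  have hM0 : 0 ≤ M := (norm_nonneg _).trans (hM 0 ⟨le_rfl, by linarith⟩)
  have hε : 0 < ε₁ := hL.trans hLε
  have hκ : 0 < L * (a ^ 2 - 1) / 16 := by
    have : 0 < a ^ 2 - 1 := by nlinarith
    positivity
  refine ⟨1 + (L * (a ^ 2 - 1) / 16)⁻¹ + 192 * ε₁ * M * a ^ 4, ?_, 2, by norm_num, ?_⟩
  · have := inv_pos.2 hκ
    have : 0 ≤ 192 * ε₁ * M * a ^ 4 := by positivity
    linarith
  intro n hn ψ _ h₁ h₂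
  obtain ⟨hlow, hupp⟩ := one_sub_sq_rpow_bounds hn h₁ h₂
  have hc34 : 3 / 4 < a * Real.cos ψ := by
    have hn' : (2 : ℝ) ≤ n := by exact_mod_cast hn
    have : 1 / (n : ℝ) ^ 2 ≤ 1 / 4 := by
      apply one_div_le_one_div_of_le <;> nlinarith
    linarith
  have hc1 : a * Real.cos ψ < 1 := by
    have : 0 < 1 / ((n : ℝ) + 1) ^ 2 := by positivity
    linarith
  have hψ : (a * Real.cos ψ) ^ 2 < 1 := by nlinarith
  refine ⟨(hasDerivAt_zetaFun hr1 L ε₁ a hψ).differentiableAt,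
    (hasDerivAt_deriv_zetaFun hr1 L ε₁ a hψ).differentiableAt, ?_⟩
  rw [deriv_deriv_zetaFun hr1 L ε₁ a hψ]
  generalize a * Real.cos ψ = c at *
  have hξ := continuous_profileXi hr0 L
  have hξ1 := one_le_profileXi hr0 L
  have hξa : ∀ s ≤ ε₁, profileXi r L s ≤ a := fun s hs => ha ▸ profileXi_le hr0 hLε.le hs
  have hpos : ∀ s, 0 < profileXi r L s ^ 2 - c ^ 2 := fun s => by nlinarith [hξ1 s]
  set Φ : ℝ → ℝ := fun s => profileA r L s * profileXi r L s ^ 2 *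
    (3 * a ^ 2 - 2 * c ^ 2 - profileXi r L s ^ 2) *
    (profileXi r L s ^ 2 - c ^ 2) ^ (-(5 / 2) : ℝ) with hΦ
  have hΦc : Continuous Φ :=
    (((continuous_profileA hr1 L).mul (hξ.pow 2)).mul (by fun_prop)).mul
      (Continuous.rpow_const (by fun_prop) fun s => Or.inl (hpos s).ne')
  have hΦi : ∀ α β : ℝ, IntervalIntegrable Φ volume α β := fun α β => hΦc.intervalIntegrable _ _
  have hfac : ∀ s ≤ ε₁, 0 ≤ 3 * a ^ 2 - 2 * c ^ 2 - profileXi r L s ^ 2 := fun s hs => by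
    nlinarith [hξ1 s, hξa s hs]
  have hΦ0 : ∀ s ≤ ε₁, 0 ≤ Φ s := fun s hs =>
    mul_nonneg (mul_nonneg (mul_nonneg (profileA_nonneg hr0 L s) (sq_nonneg _)) (hfac s hs))
      (Real.rpow_pos_of_pos (hpos s) _).le
  have hΦupp : ∀ s ∈ Set.Icc 0 ε₁, Φ s ≤ M * a ^ 2 * (3 * a ^ 2) * (32 * (n : ℝ) ^ 5) := by
    intro s hs
    have hA : profileA r L s ≤ M := (le_abs_self _).trans (hM s hs)
    have hA0 := profileA_nonneg hr0 L s
    have hD : (profileXi r L s ^ 2 - c ^ 2) ^ (-(5 / 2) : ℝ) ≤ 32 * (n : ℝ) ^ 5 :=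
      (Real.rpow_le_rpow_of_nonpos (by linarith) (by nlinarith [hξ1 s]) (by norm_num)).trans hupp
    have hD0 := (Real.rpow_pos_of_pos (hpos s) (-(5 / 2))).le
    have hf0 := hfac s hs.2
    have hξ0 : 0 ≤ profileXi r L s := by linarith [hξ1 s]
    have hf : 3 * a ^ 2 - 2 * c ^ 2 - profileXi r L s ^ 2 ≤ 3 * a ^ 2 := by
      nlinarith [sq_nonneg c]
    have := hξa s hs.2
    simp only [hΦ]
    gcongr
  have hΦlow : ∀ s ∈ Set.Icc 0 L, 2 * (a ^ 2 - 1) * ((n : ℝ) ^ 5 / 32) ≤ Φ s := by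
    intro s hs
    have hA : profileA r L s = 1 := by simp [profileA, profileXi, profileXi', hs.2]
    have hX : profileXi r L s = 1 := by simp [profileXi, hs.2]
    simp only [hΦ, hA, hX, one_pow, mul_one, one_mul]
    apply mul_le_mul _ hlow (by positivity) (by nlinarith)
    nlinarith
  have hIupp : ∫ s in (0:ℝ)..ε₁, Φ s ≤ ε₁ * (M * a ^ 2 * (3 * a ^ 2) * (32 * (n : ℝ) ^ 5)) := by
    have := intervalIntegral.integral_mono_on hε.le (hΦi 0 ε₁)
      (intervalIntegrable_const (μ := volume)) hΦupp
    rwa [intervalIntegral.integral_const, sub_zero, smul_eq_mul] at this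
  have hIlow : L * (2 * (a ^ 2 - 1) * ((n : ℝ) ^ 5 / 32)) ≤ ∫ s in (0:ℝ)..ε₁, Φ s := by
    rw [← intervalIntegral.integral_add_adjacent_intervals (hΦi 0 L) (hΦi L ε₁)]
    have h0 : 0 ≤ ∫ s in L..ε₁, Φ s :=
      intervalIntegral.integral_nonneg hLε.le fun s hs => hΦ0 s hs.2
    have hL' : L * (2 * (a ^ 2 - 1) * ((n : ℝ) ^ 5 / 32)) ≤ ∫ s in (0:ℝ)..L, Φ s := by
      have := intervalIntegral.integral_mono_on hL.le
        (intervalIntegrable_const (μ := volume)) (hΦi 0 L) hΦlow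
      rwa [intervalIntegral.integral_const, sub_zero, smul_eq_mul] at this
    linarith
  have hI0 : 0 ≤ ∫ s in (0:ℝ)..ε₁, Φ s :=
    intervalIntegral.integral_nonneg hε.le fun s hs => hΦ0 s hs.2
  have hκinv := inv_pos.2 hκ
  have hB : 0 ≤ 192 * ε₁ * M * a ^ 4 := by positivity
  have hn5 : (0 : ℝ) ≤ (n : ℝ) ^ 5 := by positivity
  constructor
  · calc (n : ℝ) ^ 5 / (1 + (L * (a ^ 2 - 1) / 16)⁻¹ + 192 * ε₁ * M * a ^ 4)
        ≤ (n : ℝ) ^ 5 / (L * (a ^ 2 - 1) / 16)⁻¹ := by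
          gcongr
          linarith
      _ = L * (2 * (a ^ 2 - 1) * ((n : ℝ) ^ 5 / 32)) := by
          rw [div_inv_eq_mul]
          ring
      _ ≤ ∫ s in (0:ℝ)..ε₁, Φ s := hIlow
      _ ≤ 2 * c * ∫ s in (0:ℝ)..ε₁, Φ s := le_mul_of_one_le_left hI0 (by linarith)
  · calc 2 * c * ∫ s in (0:ℝ)..ε₁, Φ s
        ≤ 2 * ∫ s in (0:ℝ)..ε₁, Φ s := by
          gcongr
          linarith
      _ ≤ 2 * (ε₁ * (M * a ^ 2 * (3 * a ^ 2) * (32 * (n : ℝ) ^ 5))) := by gcongr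
      _ = 192 * ε₁ * M * a ^ 4 * (n : ℝ) ^ 5 := by ring
      _ ≤ (1 + (L * (a ^ 2 - 1) / 16)⁻¹ + 192 * ε₁ * M * a ^ 4) * (n : ℝ) ^ 5 := by
          gcongr
          linarith
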